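/- The star chromatic index of the fan F_3 is at least 6; that is, F_3 admits no star 5-edge-coloring. -/

import Mathlib

/-- A star `k`-edge-coloring of `G`: a proper edge-coloring (adjacent edges get
distinct colors) such that no path and no cycle with exactly four edges is
bicolored.  The walks `v₀v₁v₂v₃v₄` with consecutive vertices adjacent and with
`v₀,v₁,v₂,v₃` pairwise distinct and `v₁,v₂,v₃,v₄` pairwise distinct are exactly
the paths (when `v₀ ≠ v₄`) and cycles (when `v₀ = v₄`) with four edges; being
bicolored under a proper coloring means the colors alternate. -/
def IsStarEdgeColoring {V : Type*} (G : SimpleGraph V) {k : ℕ} (c : Sym2 V → Fin k) : Prop :=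
  (∀ ⦃u v w : V⦄, G.Adj u v → G.Adj u w → v ≠ w → c s(u, v) ≠ c s(u, w)) ∧
  (∀ v₀ v₁ v₂ v₃ v₄ : V, G.Adj v₀ v₁ → G.Adj v₁ v₂ → G.Adj v₂ v₃ → G.Adj v₃ v₄ →
    v₀ ≠ v₂ → v₀ ≠ v₃ → v₁ ≠ v₃ → v₁ ≠ v₄ → v₂ ≠ v₄ →
    ¬(c s(v₀, v₁) = c s(v₂, v₃) ∧ c s(v₁, v₂) = c s(v₃, v₄)))

/-- The star chromatic index of `G`: the least `k` such that `G` admits a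
star `k`-edge-coloring. -/
noncomputable def starChromaticIndex {V : Type*} (G : SimpleGraph V) : ℕ :=
  sInf {k : ℕ | ∃ c : Sym2 V → Fin k, IsStarEdgeColoring G c}

/-- The fan `F₃`: vertices `v₁, …, v₅` (here `0, …, 4`) with edges
`v₁v₂, v₂v₄, v₄v₅, v₃v₁, v₃v₂, v₃v₄, v₃v₅`, i.e. the join of the path
`v₁ v₂ v₄ v₅` with the vertex `v₃`. -/
def fanF3 : SimpleGraph (Fin 5) :=
  SimpleGraph.fromRel (fun a b =>
    (a = 0 ∧ b = 1) ∨ (a = 1 ∧ b = 3) ∨ (a = 3 ∧ b = 4) ∨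
    (a = 2 ∧ b = 0) ∨ (a = 2 ∧ b = 1) ∨ (a = 2 ∧ b = 3) ∨ (a = 2 ∧ b = 4))

/-- Among at most five colors, at most one lies outside four given distinct ones. -/
theorem eq_of_outside_four_colors {k : ℕ} (hk : k ≤ 5) {p q r s x y : Fin k}
    (hpq : p ≠ q) (hpr : p ≠ r) (hps : p ≠ s) (hqr : q ≠ r) (hqs : q ≠ s) (hrs : r ≠ s)
    (hx : x ≠ p ∧ x ≠ q ∧ x ≠ r ∧ x ≠ s) (hy : y ≠ p ∧ y ≠ q ∧ y ≠ r ∧ y ≠ s) : x = y := by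
  by_contra hxy
  have hcard : ({x, y, p, q, r, s} : Finset (Fin k)).card = 6 := by
    simp [Finset.card_insert_of_notMem, *]
  have := hcard ▸ Finset.card_le_univ ({x, y, p, q, r, s} : Finset (Fin k))
  simp at this
  omega

instance : DecidableRel fanF3.Adj := by
  unfold fanF3
  infer_instance

/-- The fan `F₃` has no star edge-coloring with at most five colors. -/
theorem not_isStarEdgeColoring_fanF3 {k : ℕ} (hk : k ≤ 5) (c : Sym2 (Fin 5) → Fin k) :
    ¬ IsStarEdgeColoring fanF3 c := by
  rintro ⟨hproper, hstar⟩
  -- Each hypothesis is indexed by the vertices of the walk it concerns.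
  have h013 := @hproper 1 0 3 (by decide) (by decide) (by decide)
  have h102 := @hproper 0 1 2 (by decide) (by decide) (by decide)
  have h012 := @hproper 1 0 2 (by decide) (by decide) (by decide)
  have h134 := @hproper 3 1 4 (by decide) (by decide) (by decide)
  have h312 := @hproper 1 3 2 (by decide) (by decide) (by decide)
  have h132 := @hproper 3 1 2 (by decide) (by decide) (by decide)
  have h432 := @hproper 3 4 2 (by decide) (by decide) (by decide)
  have h342 := @hproper 4 3 2 (by decide) (by decide) (by decide)
  have h021 := @hproper 2 0 1 (by decide) (by decide) (by decide)
  have h023 := @hproper 2 0 3 (by decide) (by decide) (by decide)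
  have h024 := @hproper 2 0 4 (by decide) (by decide) (by decide)
  have h123 := @hproper 2 1 3 (by decide) (by decide) (by decide)
  have h124 := @hproper 2 1 4 (by decide) (by decide) (by decide)
  have h324 := @hproper 2 3 4 (by decide) (by decide) (by decide)
  have h20134 := hstar 2 0 1 3 4 (by decide) (by decide) (by decide) (by decide)
    (by decide) (by decide) (by decide) (by decide) (by decide)
  have h01342 := hstar 0 1 3 4 2 (by decide) (by decide) (by decide) (by decide)
    (by decide) (by decide) (by decide) (by decide) (by decide)
  have h02134 := hstar 0 2 1 3 4 (by decide) (by decide) (by decide) (by decide)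
    (by decide) (by decide) (by decide) (by decide) (by decide)
  have h02431 := hstar 0 2 4 3 1 (by decide) (by decide) (by decide) (by decide)
    (by decide) (by decide) (by decide) (by decide) (by decide)
  have h24312 := hstar 2 4 3 1 2 (by decide) (by decide) (by decide) (by decide)
    (by decide) (by decide) (by decide) (by decide) (by decide)
  have h42310 := hstar 4 2 3 1 0 (by decide) (by decide) (by decide) (by decide)
    (by decide) (by decide) (by decide) (by decide) (by decide)
  have h42013 := hstar 4 2 0 1 3 (by decide) (by decide) (by decide) (by decide)
    (by decide) (by decide) (by decide) (by decide) (by decide)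
  have h20132 := hstar 2 0 1 3 2 (by decide) (by decide) (by decide) (by decide)
    (by decide) (by decide) (by decide) (by decide) (by decide)
  have h01234 := hstar 0 1 2 3 4 (by decide) (by decide) (by decide) (by decide)
    (by decide) (by decide) (by decide) (by decide) (by decide)
  have h10234 := hstar 1 0 2 3 4 (by decide) (by decide) (by decide) (by decide)
    (by decide) (by decide) (by decide) (by decide) (by decide)
  have h34210 := hstar 3 4 2 1 0 (by decide) (by decide) (by decide) (by decide)
    (by decide) (by decide) (by decide) (by decide) (by decide)
  have h10243 := hstar 1 0 2 4 3 (by decide) (by decide) (by decide) (by decide)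
    (by decide) (by decide) (by decide) (by decide) (by decide)
  simp only [Sym2.eq_swap (a := (1 : Fin 5)) (b := 0), Sym2.eq_swap (a := (3 : Fin 5)) (b := 1),
    Sym2.eq_swap (a := (4 : Fin 5)) (b := 3), Sym2.eq_swap (a := (0 : Fin 5)) (b := 2),
    Sym2.eq_swap (a := (1 : Fin 5)) (b := 2), Sym2.eq_swap (a := (3 : Fin 5)) (b := 2),
    Sym2.eq_swap (a := (4 : Fin 5)) (b := 2)] at *
  have hout {x y : Fin k} :=
    @eq_of_outside_four_colors k hk _ _ _ _ x y h021 h023 h024 h123 h124 h324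
  have h₁ := @hout (c s(0, 1)) (c s(1, 3))
  have h₂ := @hout (c s(1, 3)) (c s(3, 4))
  have h₃ := @hout (c s(0, 1)) (c s(3, 4))
  clear hproper hstar hout
  generalize c s(0, 1) = a, c s(1, 3) = b, c s(3, 4) = d, c s(2, 0) = p, c s(2, 1) = q,
    c s(2, 3) = r, c s(2, 4) = s at *
  grind -lia -linarith -order -ring

/-- Giving all edges different colors is a star edge-coloring. -/
theorem isStarEdgeColoring_of_injective {V : Type*} (G : SimpleGraph V) {k : ℕ}
    {c : Sym2 V → Fin k} (hc : Function.Injective c) : IsStarEdgeColoring G c := by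
  refine ⟨fun u v w _ _ hvw h => hvw (Sym2.congr_right.mp (hc h)), ?_⟩
  rintro v₀ v₁ v₂ v₃ v₄ - - - - h₀₂ h₀₃ - - - ⟨h, -⟩
  have := hc h
  simp [h₀₂, h₀₃] at this

/-- The star chromatic index of the fan `F₃` is at least 6. -/
theorem starChromaticIndex_fanF3 : 6 ≤ starChromaticIndex fanF3 := by
  have hne : {k : ℕ | ∃ c : Sym2 (Fin 5) → Fin k, IsStarEdgeColoring fanF3 c}.Nonempty :=
    ⟨_, _, isStarEdgeColoring_of_injective fanF3 (Fintype.equivFin (Sym2 (Fin 5))).injective⟩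
  refine le_csInf hne ?_
  rintro k ⟨c, hc⟩
  by_contra! hk
  exact not_isStarEdgeColoring_fanF3 (by omega) c hc
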